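/- arXiv:2407.10217 — 8 statements merged into one kernel-verified Lean document; each statement's English description precedes it below -/
import Mathlib

section
/- The eleven vectors −k = 3l₀ − l₁ − ⋯ − l₁₀, r₀ = l₀ − l₁ − l₂ − l₃, rᵢ = lᵢ − l_{i+1} for 1 ≤ i ≤ 7, s₁ = 3l₀ − l₁ − ⋯ − l₉, and s₂ = 3l₀ − l₁ − ⋯ − l₈ − l₁₀ form a ℤ-basis of ℤ¹¹. Moreover, the ℤ-span of the ten vectors r₀, …, r₇, s₁, s₂ is exactly the sublattice {x ∈ ℤ¹¹ : ⟨x, k⟩ = 0} (so this sublattice, the Enriques lattice inside I_{1,10}, is free of rank 10 with this basis). -/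
/- ℤ¹¹ with the signature (1,10) bilinear form ⟨x,y⟩ = x₀y₀ − ∑_{i=1}^{10} xᵢyᵢ,
   k = −3l₀ + l₁ + ⋯ + l₁₀. -/

namespace Stmt0

/-- the intersection form of I_{1,10} -/
def form (x y : Fin 11 → ℤ) : ℤ := x 0 * y 0 - ∑ i : Fin 10, x i.succ * y i.succ

/-- k = −3l₀ + l₁ + ⋯ + l₁₀ -/
def kvec : Fin 11 → ℤ := fun j => if j = 0 then -3 else 1

/-- −k = 3l₀ − l₁ − ⋯ − l₁₀ -/
def negk : Fin 11 → ℤ := fun j => if j = 0 then 3 else -1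

/-- r₀ = l₀ − l₁ − l₂ − l₃ -/
def r0 : Fin 11 → ℤ := fun j => if j = 0 then 1 else if (j : ℕ) ≤ 3 then -1 else 0

/-- rᵢ = lᵢ − l_{i+1} -/
def rr (i : ℕ) : Fin 11 → ℤ := fun j =>
  if (j : ℕ) = i then 1 else if (j : ℕ) = i + 1 then -1 else 0

/-- s₁ = 3l₀ − l₁ − ⋯ − l₉ -/
def s1 : Fin 11 → ℤ := fun j => if j = 0 then 3 else if (j : ℕ) = 10 then 0 else -1

/-- s₂ = 3l₀ − l₁ − ⋯ − l₈ − l₁₀ -/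
def s2 : Fin 11 → ℤ := fun j => if j = 0 then 3 else if (j : ℕ) = 9 then 0 else -1

/-- the eleven vectors −k, r₀, r₁, …, r₇, s₁, s₂ -/
def v : Fin 11 → (Fin 11 → ℤ) :=
  ![negk, r0, rr 1, rr 2, rr 3, rr 4, rr 5, rr 6, rr 7, s1, s2]

/-- the ten vectors r₀, r₁, …, r₇, s₁, s₂ -/
def w : Fin 10 → (Fin 11 → ℤ) :=
  ![r0, rr 1, rr 2, rr 3, rr 4, rr 5, rr 6, rr 7, s1, s2]

/-- coordinates of an integer combination of the ten vectors -/
theorem comb_w (c : Fin 10 → ℤ) : ∑ i, c i • w i =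
    ![c 0 + 3 * c 8 + 3 * c 9, -c 0 + c 1 - c 8 - c 9, -c 0 - c 1 + c 2 - c 8 - c 9,
      -c 0 - c 2 + c 3 - c 8 - c 9, -c 3 + c 4 - c 8 - c 9, -c 4 + c 5 - c 8 - c 9,
      -c 5 + c 6 - c 8 - c 9, -c 6 + c 7 - c 8 - c 9, -c 7 - c 8 - c 9, -c 8, -c 9] := by
  funext j
  fin_cases j <;> simp [Fin.sum_univ_succ, w, r0, rr, s1, s2] <;> ring

theorem comb_v (c : Fin 11 → ℤ) : ∑ i, c i • v i =
    c 0 • negk + ∑ i : Fin 10, c i.succ • w i := by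
  rw [Fin.sum_univ_succ]
  rfl

theorem form_k (x : Fin 11 → ℤ) : form x kvec =
    -3 * x 0 - (x 1 + x 2 + x 3 + x 4 + x 5 + x 6 + x 7 + x 8 + x 9 + x 10) := by
  simp [form, kvec, Fin.sum_univ_succ]
  ring

/-- every vector orthogonal to k is a combination of the ten vectors -/
theorem exists_w (x : Fin 11 → ℤ) (hx : form x kvec = 0) :
    ∃ c : Fin 10 → ℤ, ∑ i, c i • w i = x := by
  rw [form_k] at hx
  let m := -x 9 - x 10
  let a := x 0 - 3 * m
  let b1 := x 1 + m + a
  let b2 := x 2 + m + a + b1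
  let b3 := x 3 + m + a + b2
  let b4 := x 4 + m + b3
  let b5 := x 5 + m + b4
  let b6 := x 6 + m + b5
  let b7 := x 7 + m + b6
  refine ⟨![a, b1, b2, b3, b4, b5, b6, b7, -x 9, -x 10], ?_⟩
  rw [comb_w]
  funext j
  fin_cases j <;> simp [a, b1, b2, b3, b4, b5, b6, b7, m] <;> linarith

theorem enriques_lattice_basis :
    (LinearIndependent ℤ v ∧ Submodule.span ℤ (Set.range v) = ⊤) ∧
    (Submodule.span ℤ (Set.range w) : Set (Fin 11 → ℤ)) = {x | form x kvec = 0} := by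
  refine ⟨⟨?_, ?_⟩, ?_⟩
  · rw [Fintype.linearIndependent_iff]
    intro g hg
    rw [comb_v, comb_w] at hg
    have h := fun j => congrFun hg j
    have h0 := h 0
    have h1 := h 1
    have h2 := h 2
    have h3 := h 3
    have h4 := h 4
    have h5 := h 5
    have h6 := h 6
    have h7 := h 7
    have h8 := h 8
    have h9 := h 9
    have h10 := h 10
    clear h hg
    simp [negk] at h0 h1 h2 h3 h4 h5 h6 h7 h8 h9 h10
    intro i
    fin_cases i <;> simp <;> omega
  · rw [eq_top_iff]
    intro x _
    rw [Submodule.mem_span_range_iff_exists_fun]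
    obtain ⟨c, hc⟩ := exists_w (x - form x kvec • negk) (by
      simp only [form_k]
      simp [negk]
      ring)
    refine ⟨Fin.cons (form x kvec) c, ?_⟩
    rw [comb_v]
    simp only [Fin.cons_zero, Fin.cons_succ, hc]
    abel
  · ext x
    rw [SetLike.mem_coe, Submodule.mem_span_range_iff_exists_fun, Set.mem_setOf_eq]
    refine ⟨?_, exists_w x⟩
    rintro ⟨c, rfl⟩
    rw [form_k, comb_w]
    simp
    ring

end Stmt0
end

section
/- The nine points V₁ = (3,2,2,2,2,2,2,2,2,2)/7, V₂ = (5,5,4,4,4,4,4,4,4,4)/14, V₃ = (7,7,7,6,6,6,6,6,6,6)/21, V₄ = (6,6,6,6,5,5,5,5,5,5)/18, V₅ = (5,5,5,5,5,4,4,4,4,4)/15, V₆ = (4,4,4,4,4,4,3,3,3,3)/12, V₇ = (3,3,3,3,3,3,3,2,2,2)/9, V₈ = (2,2,2,2,2,2,2,2,1,1)/6, V₉ = (1,1,1,1,1,1,1,1,1,0)/3 are affinely independent; each lies in Δ̄ and satisfies b₁ + b₂ + b₃ = 1; V₁, …, V₈ lie in Δ, while V₉ lies in Δ̄ \ Δ.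 -/
/- The nine vertices V₁, …, V₉ of the normalized fundamental chamber Δ̄. -/

namespace Stmt6

def Delta : Set (Fin 10 → ℝ) :=
  {b | ∑ i, b i = 3 ∧ b 0 + b 1 + b 2 ≤ 1 ∧ (∀ i j : Fin 10, i ≤ j → b j ≤ b i) ∧ 0 < b 9}

def DeltaBar : Set (Fin 10 → ℝ) :=
  {b | ∑ i, b i = 3 ∧ b 0 + b 1 + b 2 ≤ 1 ∧ (∀ i j : Fin 10, i ≤ j → b j ≤ b i) ∧ 0 ≤ b 9}

/-- V (i-1) is the vertex Vᵢ, 1 ≤ i ≤ 9. -/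
noncomputable def V : Fin 9 → (Fin 10 → ℝ) :=
  ![![3/7, 2/7, 2/7, 2/7, 2/7, 2/7, 2/7, 2/7, 2/7, 2/7],
    ![5/14, 5/14, 4/14, 4/14, 4/14, 4/14, 4/14, 4/14, 4/14, 4/14],
    ![7/21, 7/21, 7/21, 6/21, 6/21, 6/21, 6/21, 6/21, 6/21, 6/21],
    ![6/18, 6/18, 6/18, 6/18, 5/18, 5/18, 5/18, 5/18, 5/18, 5/18],
    ![5/15, 5/15, 5/15, 5/15, 5/15, 4/15, 4/15, 4/15, 4/15, 4/15],
    ![4/12, 4/12, 4/12, 4/12, 4/12, 4/12, 3/12, 3/12, 3/12, 3/12],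
    ![3/9, 3/9, 3/9, 3/9, 3/9, 3/9, 3/9, 2/9, 2/9, 2/9],
    ![2/6, 2/6, 2/6, 2/6, 2/6, 2/6, 2/6, 2/6, 1/6, 1/6],
    ![1/3, 1/3, 1/3, 1/3, 1/3, 1/3, 1/3, 1/3, 1/3, 0]]

theorem V_sum (i : Fin 9) : ∑ j, V i j = 3 := by
  fin_cases i <;> simp [V, Fin.sum_univ_succ] <;> norm_num

theorem V_anti (i : Fin 9) : ∀ j k : Fin 10, j ≤ k → V i k ≤ V i j := by
  have h : Antitone (V i) := by
    rw [Fin.antitone_iff_succ_le]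
    intro j
    fin_cases i <;> fin_cases j <;> simp [V] <;> norm_num
  exact fun j k hjk => h hjk

theorem V_three (i : Fin 9) : V i 0 + V i 1 + V i 2 = 1 := by
  fin_cases i <;> simp [V] <;> norm_num

theorem V_pos (i : Fin 9) (hi : i ≠ 8) : 0 < V i 9 := by
  fin_cases i <;> simp [V] at hi ⊢

theorem V_last : V 8 9 = 0 := by
  simp [V]

theorem V_bar (i : Fin 9) : V i ∈ DeltaBar := by
  refine ⟨V_sum i, (V_three i).le, V_anti i, ?_⟩
  by_cases hi : i = 8
  · rw [hi, V_last]
  · exact (V_pos i hi).le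

theorem V_linInd : LinearIndependent ℝ V := by
  rw [Fintype.linearIndependent_iff]
  intro g hg
  -- only `Vᵢ` has a drop between the coordinates `i` and `i + 1`
  have key : ∀ k : Fin 9, ∑ i, g i * (V i k.castSucc - V i k.succ) = 0 := by
    intro k
    have h1 := congrFun hg k.castSucc
    have h2 := congrFun hg k.succ
    simp only [Finset.sum_apply, Pi.smul_apply, smul_eq_mul, Pi.zero_apply] at h1 h2
    simp only [mul_sub, Finset.sum_sub_distrib, h1, h2, sub_zero]
  have drop : ∀ i k : Fin 9, i ≠ k → V i k.castSucc - V i k.succ = 0 := by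
    intro i k hik
    fin_cases i <;> fin_cases k <;> simp [V] at hik ⊢
  have drop' : ∀ k : Fin 9, V k k.castSucc - V k k.succ ≠ 0 := by
    intro k
    fin_cases k <;> simp [V] <;> norm_num
  intro k
  have h := key k
  rw [Finset.sum_eq_single k (fun i _ hik => by rw [drop i k hik, mul_zero])
    (fun hk => absurd (Finset.mem_univ k) hk)] at h
  exact (mul_eq_zero.mp h).resolve_right (drop' k)

theorem vertices :
    AffineIndependent ℝ V ∧
    (∀ i : Fin 9, V i ∈ DeltaBar ∧ V i 0 + V i 1 + V i 2 = 1) ∧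
    (∀ i : Fin 9, i ≠ 8 → V i ∈ Delta) ∧
    V 8 ∈ DeltaBar \ Delta := by
  refine ⟨V_linInd.affineIndependent, fun i => ⟨V_bar i, V_three i⟩,
    fun i hi => ⟨V_sum i, (V_three i).le, V_anti i, V_pos i hi⟩, V_bar 8, ?_⟩
  rintro ⟨_, _, _, h⟩
  rw [V_last] at h
  exact lt_irrefl _ h

end Stmt6
end

section
/- For every (b₁, …, b₁₀) ∈ Δ one has ∑_{i=1}^{10} bᵢ² < 1. Equivalently, the vector b = l₀ − ∑_{i=1}^{10} bᵢlᵢ ∈ ℝ¹¹ satisfies ⟨b, b⟩ > 0 and ⟨b, l₀⟩ > 0, i.e., b lies in the forward component of the positive cone {x : ⟨x, x⟩ > 0}. -/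
/- For (b₁,…,b₁₀) ∈ Δ one has ∑bᵢ² < 1; equivalently b = l₀ − ∑bᵢlᵢ lies in the
   forward component of the positive cone of the signature (1,10) form on ℝ¹¹. -/

namespace Stmt7

def formR (x y : Fin 11 → ℝ) : ℝ := x 0 * y 0 - ∑ i : Fin 10, x i.succ * y i.succ

def Delta : Set (Fin 10 → ℝ) :=
  {b | ∑ i, b i = 3 ∧ b 0 + b 1 + b 2 ≤ 1 ∧ (∀ i j : Fin 10, i ≤ j → b j ≤ b i) ∧ 0 < b 9}

theorem delta_in_forward_cone (b : Fin 10 → ℝ) (hb : b ∈ Delta) :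
    (∑ i, (b i) ^ 2 < 1) ∧
    0 < formR (Fin.cons 1 fun i => -b i) (Fin.cons 1 fun i => -b i) ∧
    0 < (Fin.cons 1 fun i => -b i : Fin 11 → ℝ) 0 := by
  have key : ∑ i, (b i) ^ 2 < 1 := by
    obtain ⟨hs, hT, hm, h9⟩ := hb
    have m01 := hm 0 1 (by decide)
    have m12 := hm 1 2 (by decide)
    have hle : ∀ i : Fin 10, 2 ≤ i → b i * (b 2 - b i) ≥ 0 := fun i hi =>
      mul_nonneg (h9.le.trans (hm i 9 (by omega))) (sub_nonneg.2 (hm 2 i hi))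
    have h3 := hle 3 (by decide)
    have h4 := hle 4 (by decide)
    have h5 := hle 5 (by decide)
    have h6 := hle 6 (by decide)
    have h7 := hle 7 (by decide)
    have h8 := hle 8 (by decide)
    have h9' := hle 9 (by decide)
    have n0 := hm 0 9 (by decide)
    have n1 := hm 1 9 (by decide)
    have n2 := hm 2 9 (by decide)
    have n3 := hm 3 9 (by decide)
    have n4 := hm 4 9 (by decide)
    have n5 := hm 5 9 (by decide)
    have n6 := hm 6 9 (by decide)
    have n7 := hm 7 9 (by decide)
    have n8 := hm 8 9 (by decide)
    simp only [Fin.sum_univ_succ, Fin.sum_univ_zero] at hs ⊢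
    simp only [Fin.reduceSucc, add_zero] at hs ⊢
    have hc : b 2 ≤ 1 / 3 := by linarith
    have hc0 : 0 < b 2 := by linarith
    have hn : b 9 ≤ 3 / 10 := by linarith
    have p1 : 0 ≤ (b 0 - b 2) * (b 1 - b 2) := mul_nonneg (by linarith) (by linarith)
    have p2 : 0 ≤ (b 0 + b 1 + b 2 - 3 * b 2) * (1 - (b 0 + b 1 + b 2)) :=
      mul_nonneg (by linarith) (by linarith)
    have p3 : 0 ≤ (1 - 2 * b 2) * (1 - (b 0 + b 1 + b 2)) :=
      mul_nonneg (by linarith) (by linarith)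
    have e : b 2 * (b 0 + (b 1 + (b 2 + (b 3 + (b 4 + (b 5 + (b 6 + (b 7 + (b 8 + b 9)))))))))
        = b 2 * 3 := by rw [hs]
    rcases hc.lt_or_eq with h | h
    · have p4 : 0 < b 2 * (1 - 3 * b 2) := mul_pos hc0 (by linarith)
      nlinarith
    · have p4 : 0 < b 9 * (b 2 - b 9) := mul_pos h9 (by linarith)
      have p5 : b 2 * (1 - 3 * b 2) = 0 := by rw [h]; norm_num
      nlinarith
  refine ⟨key, ?_, by simp⟩
  have : formR (Fin.cons 1 fun i => -b i) (Fin.cons 1 fun i => -b i) = 1 - ∑ i, (b i) ^ 2 := by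
    simp [formR, pow_two]
  rw [this]
  linarith

end Stmt7
end

section
/- (Φ-invariant equals b₁₀.) Let (b₁, …, b₁₀) ∈ Δ and set b = l₀ − ∑_{i=1}^{10} bᵢlᵢ ∈ ℝ¹¹. Then: (i) ⟨b, s₁⟩ = b₁₀, where s₁ = 3l₀ − l₁ − ⋯ − l₉; and (ii) for every nonzero F ∈ ℤ¹¹ with ⟨F, k⟩ = 0 and ⟨F, F⟩ = 0 one has |⟨b, F⟩| ≥ b₁₀. Consequently, the minimum of |⟨b, F⟩| over nonzero isotropic integer vectors F orthogonal to k equals b₁₀. -/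
/- Φ-invariant equals b₁₀: for b = l₀ − ∑bᵢlᵢ with (b₁,…,b₁₀) ∈ Δ,
   ⟨b, s₁⟩ = b₁₀, and |⟨b, F⟩| ≥ b₁₀ for every nonzero isotropic integral F ⊥ k;
   hence min |⟨b,F⟩| = b₁₀. -/

namespace Stmt8

def formR (x y : Fin 11 → ℝ) : ℝ := x 0 * y 0 - ∑ i : Fin 10, x i.succ * y i.succ

def formZ (x y : Fin 11 → ℤ) : ℤ := x 0 * y 0 - ∑ i : Fin 10, x i.succ * y i.succ

def kvec : Fin 11 → ℤ := fun j => if j = 0 then -3 else 1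

/-- s₁ = 3l₀ − l₁ − ⋯ − l₉ (as a real vector) -/
def s1R : Fin 11 → ℝ := fun j => if j = 0 then 3 else if (j : ℕ) = 10 then 0 else -1

def Delta : Set (Fin 10 → ℝ) :=
  {b | ∑ i, b i = 3 ∧ b 0 + b 1 + b 2 ≤ 1 ∧ (∀ i j : Fin 10, i ≤ j → b j ≤ b i) ∧ 0 < b 9}

/-- Dominant case: sorted with `m 0 + m 1 + m 2 ≤ d`. -/
theorem dominant_case (b : Fin 10 → ℝ) (hsum : ∑ i, b i = 3)
    (hanti : ∀ i j : Fin 10, i ≤ j → b j ≤ b i) (hpos : 0 < b 9)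
    (d : ℤ) (hd : 0 < d) (m : Fin 10 → ℤ) (hm : Antitone m)
    (h1 : ∑ i, m i = 3 * d) (h2 : ∑ i, m i * m i = d * d) (hdom : m 0 + m 1 + m 2 ≤ d) :
    ∑ i, b i * (m i : ℝ) ≤ d - b 9 := by
  have e : ∀ i j : Fin 10, i ≤ j → m j ≤ m i := fun i j h => hm h
  have e1 := e 0 1 (by decide)
  have e2 := e 1 2 (by decide)
  have e3 := e 2 3 (by decide)
  have e4 := e 3 4 (by decide)
  have e5 := e 4 5 (by decide)
  have e6 := e 5 6 (by decide)
  have e7 := e 6 7 (by decide)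
  have e8 := e 7 8 (by decide)
  have e9 := e 8 9 (by decide)
  have s1 : m 0 + m 1 + m 2 + m 3 + m 4 + m 5 + m 6 + m 7 + m 8 + m 9 = 3 * d := by
    rw [← h1]; simp [Fin.sum_univ_succ]; ring_nf
  have n9 : 0 ≤ m 9 := by linarith
  have hn : ∀ i, 0 ≤ m i := fun i => n9.trans (e i 9 (Fin.le_last i))
  -- the key convexity estimate
  have key : ∑ i, m i * m i ≤ ∑ i, m 2 * m i + (m 0 - m 2) * m 0 + (m 1 - m 2) * m 1 := by
    have t : ∀ i : Fin 10, 2 ≤ i → m i * m i ≤ m 2 * m i := fun i hi =>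
      mul_le_mul_of_nonneg_right (e 2 i hi) (hn i)
    have t3 := t 3 (by decide)
    have t4 := t 4 (by decide)
    have t5 := t 5 (by decide)
    have t6 := t 6 (by decide)
    have t7 := t 7 (by decide)
    have t8 := t 8 (by decide)
    have t9 := t 9 (by decide)
    have a1 : ∑ i, m i * m i = m 0 * m 0 + m 1 * m 1 + m 2 * m 2 + m 3 * m 3 + m 4 * m 4
        + m 5 * m 5 + m 6 * m 6 + m 7 * m 7 + m 8 * m 8 + m 9 * m 9 := by
      simp [Fin.sum_univ_succ]; ring_nf
    have a2 : ∑ i, m 2 * m i = m 2 * m 0 + m 2 * m 1 + m 2 * m 2 + m 2 * m 3 + m 2 * m 4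
        + m 2 * m 5 + m 2 * m 6 + m 2 * m 7 + m 2 * m 8 + m 2 * m 9 := by
      simp [Fin.sum_univ_succ]; ring_nf
    rw [a1, a2]; linarith
  rw [h2, ← Finset.mul_sum, h1] at key
  have t0 : 0 < m 2 := by
    rcases (hn 2).lt_or_eq with h | h
    · exact h
    · linarith [hn 0, hn 1]
  have h3 : d = 3 * m 2 := by
    obtain ⟨a, ha⟩ : ∃ a, a = m 0 - m 2 := ⟨_, rfl⟩
    obtain ⟨c, hc⟩ : ∃ c, c = m 1 - m 2 := ⟨_, rfl⟩
    obtain ⟨t, ht⟩ : ∃ t, t = m 2 := ⟨_, rfl⟩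
    have ha' : m 0 = a + t := by linarith
    have hc' : m 1 = c + t := by linarith
    rw [ha', hc', ← ht] at key
    rw [← ht] at t0 ⊢
    have a0 : 0 ≤ a := by linarith
    have c0 : 0 ≤ c := by linarith
    have hac : a + c ≤ d - 3 * t := by linarith
    have q : (a + c) * (a + c + t) ≤ (d - 3 * t) * (d - 3 * t + t) :=
      mul_le_mul hac (by linarith) (by linarith) (by linarith)
    have r : t * (d - 3 * t) ≤ 0 := by nlinarith [mul_nonneg a0 c0]
    nlinarith
  have hle : ∀ i, m i ≤ m 2 := by
    intro i
    have := e 0 i (Fin.zero_le i)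
    linarith
  have fin : b 9 * ∑ i, ((m 2 : ℝ) - m i) ≤ ∑ i, b i * ((m 2 : ℝ) - m i) := by
    rw [Finset.mul_sum]
    refine Finset.sum_le_sum fun i _ => mul_le_mul_of_nonneg_right (hanti i 9 (Fin.le_last i)) ?_
    have : (m i : ℝ) ≤ m 2 := by exact_mod_cast hle i
    linarith
  have h1' : ∑ i, (m i : ℝ) = 3 * d := by exact_mod_cast h1
  have h3' : (d : ℝ) = 3 * m 2 := by exact_mod_cast h3
  have t1 : (1 : ℝ) ≤ m 2 := by exact_mod_cast t0
  simp only [mul_sub, Finset.sum_sub_distrib, ← Finset.sum_mul, hsum, h1'] at fin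
  simp at fin
  nlinarith

theorem lower_bound (b : Fin 10 → ℝ) (hb : b ∈ Delta) (n : ℕ) :
    ∀ (d : ℤ) (m : Fin 10 → ℤ), d ≤ n → 0 < d → ∑ i, m i = 3 * d → ∑ i, m i * m i = d * d →
    ∑ i, b i * (m i : ℝ) ≤ d - b 9 := by
  obtain ⟨hsum, h123, hanti, hpos⟩ := hb
  induction n with
  | zero => intro d m h h'; simp at h; omega
  | succ n ih =>
    intro d m' hdn hd h1' h2'
    let σ : Equiv.Perm (Fin 10) := Tuple.sort (fun i => -m' i)
    have hσ : Monotone ((fun i => -m' i) ∘ σ) := Tuple.monotone_sort _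
    obtain ⟨m, hmdef⟩ : ∃ m : Fin 10 → ℤ, m = m' ∘ σ := ⟨_, rfl⟩
    have hm : Antitone m := by
      intro i j hij
      have := hσ hij
      simp only [Function.comp] at this
      rw [hmdef]; simp only [Function.comp]; linarith
    have h1 : ∑ i, m i = 3 * d := by
      rw [← h1', hmdef]; exact Equiv.sum_comp σ m'
    have h2 : ∑ i, m i * m i = d * d := by
      rw [← h2', hmdef]; exact Equiv.sum_comp σ (fun i => m' i * m' i)
    have hre : ∑ i, b i * (m' i : ℝ) ≤ ∑ i, b i * (m i : ℝ) := by
      have hb' : Antitone b := fun i j h => hanti i j h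
      have hmR : Antitone (fun i => (m i : ℝ)) := fun i j h => by
        simpa using hm h
      have := (hb'.monovary hmR).sum_mul_comp_perm_le_sum_mul (σ := σ⁻¹)
      simpa [hmdef] using this
    refine hre.trans ?_
    by_cases hdom : m 0 + m 1 + m 2 ≤ d
    · exact dominant_case b hsum hanti hpos d hd m hm h1 h2 hdom
    · push Not at hdom
      obtain ⟨c, hc⟩ : ∃ c, c = m 0 + m 1 + m 2 - d := ⟨_, rfl⟩
      have hc0 : 0 < c := by linarith
      have hcd : c < d := by
        have hs : m 0 * m 0 + m 1 * m 1 + m 2 * m 2 ≤ d * d := by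
          rw [← h2]
          have : ∑ i ∈ ({0, 1, 2} : Finset (Fin 10)), m i * m i ≤ ∑ i, m i * m i :=
            Finset.sum_le_sum_of_subset_of_nonneg (Finset.subset_univ _)
              fun i _ _ => mul_self_nonneg _
          simpa [add_assoc] using this
        by_contra! hh
        have h4 : 2 * d ≤ m 0 + m 1 + m 2 := by linarith
        have h5 : (2 * d) * (2 * d) ≤ (m 0 + m 1 + m 2) * (m 0 + m 1 + m 2) :=
          mul_le_mul h4 h4 (by linarith) (by linarith)
        nlinarith [sq_nonneg (m 0 - m 1), sq_nonneg (m 0 - m 2), sq_nonneg (m 1 - m 2)]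
      let r : Fin 10 → ℤ := fun i => if i ≤ 2 then m i - c else m i
      have := ih (d - c) r (by push_cast at hdn; linarith) (by linarith)
        (by
          simp only [Fin.sum_univ_succ] at h1 ⊢
          simp [r, Fin.le_def] at h1 ⊢
          linarith)
        (by
          simp only [Fin.sum_univ_succ] at h2 ⊢
          simp [r, Fin.le_def] at h2 ⊢
          have hd' : m 2 = c + d - m 0 - m 1 := by linarith
          rw [hd'] at h2 ⊢
          linarith)
      have hr : ∑ i, b i * (r i : ℝ) = ∑ i, b i * (m i : ℝ) - c * (b 0 + b 1 + b 2) := by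
        simp [Fin.sum_univ_succ, r, Fin.le_def]
        ring
      rw [hr] at this
      push_cast at this
      have hcR : (0 : ℝ) < c := by exact_mod_cast hc0
      nlinarith

theorem bound_main (b : Fin 10 → ℝ) (hb : b ∈ Delta) (F : Fin 11 → ℤ) (hF : F ≠ 0)
    (hk : formZ F kvec = 0) (hi : formZ F F = 0) :
    b 9 ≤ |formR (Fin.cons 1 fun i => -b i) (fun j => (F j : ℝ))| := by
  have hk' : ∑ i : Fin 10, F i.succ = -3 * F 0 := by
    simp [formZ, kvec] at hk
    linarith
  have hi' : ∑ i : Fin 10, F i.succ * F i.succ = F 0 * F 0 := by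
    simp only [formZ] at hi; linarith
  have hv : formR (Fin.cons 1 fun i => -b i) (fun j => (F j : ℝ))
      = F 0 + ∑ i : Fin 10, b i * (F i.succ : ℝ) := by
    simp [formR]
  rw [hv]
  rcases lt_trichotomy (F 0) 0 with h | h | h
  · have := lower_bound b hb (-F 0).toNat (-F 0) (fun i => F i.succ) (Int.self_le_toNat _)
      (by linarith) (by rw [hk']; ring) (by rw [hi']; ring)
    push_cast at this
    refine le_trans ?_ (neg_le_abs _)
    linarith
  · exfalso
    apply hF
    rw [h, mul_zero, Finset.sum_eq_zero_iff_of_nonneg (fun i _ => mul_self_nonneg _)] at hi'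
    funext j
    refine Fin.cases h (fun i => ?_) j
    simpa using hi' i (Finset.mem_univ i)
  · have := lower_bound b hb (F 0).toNat (F 0) (fun i => -F i.succ) (Int.self_le_toNat _)
      h (by rw [Finset.sum_neg_distrib, hk']; ring) (by simp only [neg_mul_neg]; exact hi')
    push_cast at this
    simp only [mul_neg, Finset.sum_neg_distrib] at this
    refine le_trans ?_ (le_abs_self _)
    linarith

theorem phi_invariant_eq_b10 (b : Fin 10 → ℝ) (hb : b ∈ Delta) :
    -- (i) the value b₁₀ is attained at F = s₁
    formR (Fin.cons 1 fun i => -b i) s1R = b 9 ∧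
    -- (ii) b₁₀ is a lower bound over all nonzero isotropic F orthogonal to k
    (∀ F : Fin 11 → ℤ, F ≠ 0 → formZ F kvec = 0 → formZ F F = 0 →
      b 9 ≤ |formR (Fin.cons 1 fun i => -b i) (fun j => (F j : ℝ))|) ∧
    -- consequently b₁₀ is the minimum of |⟨b,F⟩|
    IsLeast {t : ℝ | ∃ F : Fin 11 → ℤ, F ≠ 0 ∧ formZ F kvec = 0 ∧ formZ F F = 0 ∧
      t = |formR (Fin.cons 1 fun i => -b i) (fun j => (F j : ℝ))|} (b 9) := by
  have hi : formR (Fin.cons 1 fun i => -b i) s1R = b 9 := by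
    have hs := hb.1
    simp only [Fin.sum_univ_succ] at hs
    simp [formR, s1R, Fin.sum_univ_succ] at hs ⊢
    linarith
  refine ⟨hi, bound_main b hb, ?_, ?_⟩
  · refine ⟨fun j => if j = 0 then 3 else if (j : ℕ) = 10 then 0 else -1, ?_, ?_, ?_, ?_⟩
    · intro h
      have := congrFun h 0
      simp at this
    · decide
    · decide
    · have : (fun j : Fin 11 => (((if j = 0 then 3 else if (j : ℕ) = 10 then 0 else -1 : ℤ)) : ℝ))
          = s1R := by
        funext j
        simp only [s1R]
        split_ifs <;> simp
      rw [this, hi, abs_of_pos hb.2.2.2]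
  · rintro t ⟨F, h0, h1, h2, rfl⟩
    exact bound_main b hb F h0 h1 h2


end Stmt8
end

section
/- (Lattice content of Φ = c₀^{alg}.) Let (b₁, …, b₁₀) ∈ Δ and set b = l₀ − ∑_{i=1}^{10} bᵢlᵢ ∈ ℝ¹¹. For every F = c·l₀ − ∑_{i=1}^{10} dᵢlᵢ ∈ ℤ¹¹ with c > 0, ∑_{i=1}^{10} dᵢ = 3c, and ∑_{i=1}^{10} dᵢ² ≤ c² (i.e., ⟨F, k⟩ = 0, ⟨F, F⟩ ≥ 0, and ⟨F, l₀⟩ > 0), one has ⟨b, F⟩ ≥ b₁₀. The bound is attained at F = s₁ = 3l₀ − l₁ − ⋯ − l₉, so the minimum of ⟨b, F⟩ over all such F equals b₁₀. -/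
/- Lattice content of Φ = c₀^{alg}: for b = l₀ − ∑bᵢlᵢ with (b₁,…,b₁₀) ∈ Δ and every
   F = c·l₀ − ∑dᵢlᵢ with c > 0, ∑dᵢ = 3c, ∑dᵢ² ≤ c², one has ⟨b, F⟩ ≥ b₁₀;
   the bound is attained at F = s₁, so the minimum is b₁₀. -/

namespace Stmt9

def formR (x y : Fin 11 → ℝ) : ℝ := x 0 * y 0 - ∑ i : Fin 10, x i.succ * y i.succ

/-- s₁ = 3l₀ − l₁ − ⋯ − l₉ (as a real vector) -/
def s1R : Fin 11 → ℝ := fun j => if j = 0 then 3 else if (j : ℕ) = 10 then 0 else -1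

def Delta : Set (Fin 10 → ℝ) :=
  {b | ∑ i, b i = 3 ∧ b 0 + b 1 + b 2 ≤ 1 ∧ (∀ i j : Fin 10, i ≤ j → b j ≤ b i) ∧ 0 < b 9}

lemma sum_ten {M : Type*} [AddCommMonoid M] (f : Fin 10 → M) : ∑ i, f i =
    f 0 + f 1 + f 2 + f 3 + f 4 + f 5 + f 6 + f 7 + f 8 + f 9 := by
  simp only [Fin.sum_univ_castSucc, Fin.sum_univ_zero, zero_add]
  rfl

/-- The inequality for vectors in the fundamental chamber. -/
lemma dominant_case (b : Fin 10 → ℝ) (hb : b ∈ Delta) (c : ℤ) (d : Fin 10 → ℤ) (hc : 0 < c)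
    (hs : ∑ i, d i = 3 * c) (hd : ∀ i j : Fin 10, i ≤ j → d j ≤ d i)
    (h3 : d 0 + d 1 + d 2 ≤ c) : b 9 ≤ (c : ℝ) - ∑ i, b i * (d i : ℝ) := by
  obtain ⟨hb1, hb2, hb3, hb4⟩ := hb
  rw [sum_ten] at hs hb1 ⊢
  have e0 := hd 0 1 (by decide)
  have f0 := hb3 0 1 (by decide)
  have e1 := hd 1 2 (by decide)
  have f1 := hb3 1 2 (by decide)
  have e2 := hd 2 3 (by decide)
  have f2 := hb3 2 3 (by decide)
  have e3 := hd 3 4 (by decide)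
  have f3 := hb3 3 4 (by decide)
  have e4 := hd 4 5 (by decide)
  have f4 := hb3 4 5 (by decide)
  have e5 := hd 5 6 (by decide)
  have f5 := hb3 5 6 (by decide)
  have e6 := hd 6 7 (by decide)
  have f6 := hb3 6 7 (by decide)
  have e7 := hd 7 8 (by decide)
  have f7 := hb3 7 8 (by decide)
  have e8 := hd 8 9 (by decide)
  have f8 := hb3 8 9 (by decide)
  generalize d 0 = d0 at *
  generalize d 1 = d1 at *
  generalize d 2 = d2 at *
  generalize d 3 = d3 at *
  generalize d 4 = d4 at *
  generalize d 5 = d5 at *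
  generalize d 6 = d6 at *
  generalize d 7 = d7 at *
  generalize d 8 = d8 at *
  generalize d 9 = d9 at *
  have hn : 1 ≤ (c - d0 - d1 - d2) + (d0 - d9) := by omega
  have q0 : 0 ≤ c - 3 := by linarith
  have q1 : 0 ≤ 1 * (c - 3) + 1 - d0 := by linarith
  have q2 : 0 ≤ 2 * (c - 3) + 2 - d0 - d1 := by linarith
  have q3 : 0 ≤ 3 * (c - 3) + 3 - d0 - d1 - d2 := by linarith
  have q4 : 0 ≤ 3 * (c - 3) + 4 - d0 - d1 - d2 - d3 := by linarith
  have q5 : 0 ≤ 3 * (c - 3) + 5 - d0 - d1 - d2 - d3 - d4 := by linarith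
  have q6 : 0 ≤ 3 * (c - 3) + 6 - d0 - d1 - d2 - d3 - d4 - d5 := by linarith
  have q7 : 0 ≤ 3 * (c - 3) + 7 - d0 - d1 - d2 - d3 - d4 - d5 - d6 := by linarith
  have q8 : 0 ≤ 3 * (c - 3) + 8 - d0 - d1 - d2 - d3 - d4 - d5 - d6 - d7 := by linarith
  have q9 : 0 ≤ 3 * (c - 3) + 9 - d0 - d1 - d2 - d3 - d4 - d5 - d6 - d7 - d8 := by linarith
  have r0 := (Int.cast_nonneg (R := ℝ)) q0
  have r1 := (Int.cast_nonneg (R := ℝ)) q1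
  have r2 := (Int.cast_nonneg (R := ℝ)) q2
  have r3 := (Int.cast_nonneg (R := ℝ)) q3
  have r4 := (Int.cast_nonneg (R := ℝ)) q4
  have r5 := (Int.cast_nonneg (R := ℝ)) q5
  have r6 := (Int.cast_nonneg (R := ℝ)) q6
  have r7 := (Int.cast_nonneg (R := ℝ)) q7
  have r8 := (Int.cast_nonneg (R := ℝ)) q8
  have r9 := (Int.cast_nonneg (R := ℝ)) q9
  push_cast at r0 r1 r2 r3 r4 r5 r6 r7 r8 r9
  have hsR : (d0 : ℝ) + (d1 : ℝ) + (d2 : ℝ) + (d3 : ℝ) + (d4 : ℝ) + (d5 : ℝ) + (d6 : ℝ) + (d7 : ℝ) + (d8 : ℝ) + (d9 : ℝ) = 3 * c := by exact_mod_cast hs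
  have p0 := mul_nonneg (sub_nonneg.2 hb2) r0
  have p1 := mul_nonneg (sub_nonneg.2 f0) r1
  have p2 := mul_nonneg (sub_nonneg.2 f1) r2
  have p3 := mul_nonneg (sub_nonneg.2 f2) r3
  have p4 := mul_nonneg (sub_nonneg.2 f3) r4
  have p5 := mul_nonneg (sub_nonneg.2 f4) r5
  have p6 := mul_nonneg (sub_nonneg.2 f5) r6
  have p7 := mul_nonneg (sub_nonneg.2 f6) r7
  have p8 := mul_nonneg (sub_nonneg.2 f7) r8
  have p9 := mul_nonneg (sub_nonneg.2 f8) r9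
  have key : 0 ≤ (c : ℝ) - (b 0 * (d0 : ℝ) + b 1 * (d1 : ℝ) + b 2 * (d2 : ℝ) + b 3 * (d3 : ℝ) + b 4 * (d4 : ℝ) + b 5 * (d5 : ℝ) + b 6 * (d6 : ℝ) + b 7 * (d7 : ℝ) + b 8 * (d8 : ℝ) + b 9 * (d9 : ℝ)) - b 9 := by
    refine le_of_le_of_eq (add_nonneg (add_nonneg (add_nonneg (add_nonneg (add_nonneg (add_nonneg (add_nonneg (add_nonneg (add_nonneg p0 p1) p2) p3) p4) p5) p6) p7) p8) p9) ?_
    linear_combination hb1 + b 9 * hsR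
  linarith

/-- Descent on `c`: sort, then reflect in `l₀ - l₁ - l₂ - l₃` when this lowers `c`. -/
lemma lower_bound (b : Fin 10 → ℝ) (hb : b ∈ Delta) (n : ℕ) :
    ∀ (c : ℤ) (d : Fin 10 → ℤ), c.toNat = n → 0 < c → ∑ i, d i = 3 * c →
      ∑ i, (d i) ^ 2 ≤ c ^ 2 → b 9 ≤ (c : ℝ) - ∑ i, b i * (d i : ℝ) := by
  induction n using Nat.strong_induction_on with
  | _ n ih =>
  intro c d hcn hc hs hq
  obtain ⟨σ, hσ⟩ : ∃ σ : Equiv.Perm (Fin 10), ∀ i j, i ≤ j → d (σ j) ≤ d (σ i) := by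
    refine ⟨Tuple.sort (fun i => - d i), fun i j hij => ?_⟩
    have := Tuple.monotone_sort (fun i => - d i) hij
    simpa using this
  set e : Fin 10 → ℤ := fun i => d (σ i) with he
  have hse : ∑ i, e i = 3 * c := by rw [← hs]; exact Equiv.sum_comp σ d
  have hqe : ∑ i, (e i) ^ 2 ≤ c ^ 2 := by
    refine le_of_eq_of_le ?_ hq; exact Equiv.sum_comp σ (fun i => d i ^ 2)
  have hre : ∑ i, b i * (d i : ℝ) ≤ ∑ i, b i * (e i : ℝ) := by
    have hm : Monovary b (fun i => (e i : ℝ)) := by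
      have h1 : Antitone b := fun i j hij => hb.2.2.1 i j hij
      have h2 : Antitone (fun i => (e i : ℝ)) := fun i j hij => Int.cast_le.2 (hσ i j hij)
      exact h1.monovary h2
    have := hm.sum_mul_comp_perm_le_sum_mul (σ := σ⁻¹)
    simpa [he] using this
  suffices h : b 9 ≤ (c : ℝ) - ∑ i, b i * (e i : ℝ) by linarith
  replace hσ : ∀ i j, i ≤ j → e j ≤ e i := hσ
  clear_value e
  by_cases h3 : e 0 + e 1 + e 2 ≤ c
  · exact dominant_case b hb c e hc hse hσ h3
  push Not at h3
  obtain ⟨t, ht⟩ : ∃ t, t = e 0 + e 1 + e 2 - c := ⟨_, rfl⟩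
  have hb2 := hb.2.1
  have hcpos : 0 < c - t := by
    rw [sum_ten] at hqe
    by_contra hneg
    nlinarith [sq_nonneg (e 0 - e 1), sq_nonneg (e 0 - e 2), sq_nonneg (e 1 - e 2),
      sq_nonneg (e 3), sq_nonneg (e 4), sq_nonneg (e 5), sq_nonneg (e 6), sq_nonneg (e 7),
      sq_nonneg (e 8), sq_nonneg (e 9)]
  have hstep := ih (c - t).toNat (by omega) (c - t)
    ![e 0 - t, e 1 - t, e 2 - t, e 3, e 4, e 5, e 6, e 7, e 8, e 9] rfl hcpos
    (by rw [sum_ten] at hse ⊢; simp; linarith)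
    (by
      rw [sum_ten] at hqe ⊢
      simp only [Matrix.cons_val]
      refine le_of_sub_nonneg (le_of_le_of_eq (sub_nonneg.2 hqe) ?_)
      rw [ht]; ring)
  refine hstep.trans ?_
  rw [sum_ten, sum_ten]
  simp only [Matrix.cons_val]
  push_cast
  have htR : (0 : ℝ) ≤ t := by
    have : 0 ≤ t := by omega
    exact_mod_cast this
  nlinarith [mul_nonneg htR (sub_nonneg.2 hb2)]

theorem nef_pairing_lower_bound (b : Fin 10 → ℝ) (hb : b ∈ Delta) :
    -- lower bound: ⟨b, F⟩ ≥ b₁₀ for every F = c·l₀ − ∑dᵢlᵢ with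
    -- c > 0, ∑dᵢ = 3c and ∑dᵢ² ≤ c²
    (∀ (c : ℤ) (d : Fin 10 → ℤ), 0 < c → ∑ i, d i = 3 * c → ∑ i, (d i) ^ 2 ≤ c ^ 2 →
      b 9 ≤ formR (Fin.cons 1 fun i => -b i) (Fin.cons (c : ℝ) fun i => -(d i : ℝ))) ∧
    -- the bound is attained at s₁ = 3l₀ − l₁ − ⋯ − l₉
    formR (Fin.cons 1 fun i => -b i) s1R = b 9 := by
  constructor
  · intro c d hc hs hq
    have := lower_bound b hb _ c d rfl hc hs hq
    simpa [formR] using this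
  · have h := hb.1
    rw [sum_ten] at h
    unfold formR
    rw [sum_ten]
    simp only [Fin.cons_succ, Fin.cons_zero]
    simp [s1R]
    linarith


end Stmt9
end

section
/- Every nonzero vector F = c·l₀ − ∑_{i=1}^{10} dᵢlᵢ ∈ ℤ¹¹ with ∑_{i=1}^{10} dᵢ = 3c and ∑_{i=1}^{10} dᵢ² = c² satisfies |c| ≥ 3. That is, every nonzero isotropic integer vector orthogonal to k pairs with l₀ in absolute value at least 3; the value 3 is attained by s₁ = 3l₀ − l₁ − ⋯ − l₉. -/
/- Every nonzero isotropic integer vector F = c·l₀ − ∑dᵢlᵢ orthogonal to k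
   (i.e. ∑dᵢ = 3c and ∑dᵢ² = c²) satisfies |c| ≥ 3; the value 3 is attained by
   s₁ = 3l₀ − l₁ − ⋯ − l₉, i.e. c = 3, d = (1,…,1,0). -/

theorem isotropic_pairs_at_least_three :
    (∀ (c : ℤ) (d : Fin 10 → ℤ), ¬(c = 0 ∧ d = 0) →
      ∑ i, d i = 3 * c → ∑ i, (d i) ^ 2 = c ^ 2 → 3 ≤ |c|) ∧
    -- attainment at s₁ : c = 3, d = (1,…,1,0)
    (∑ i : Fin 10, (if i = 9 then (0 : ℤ) else 1) = 3 * 3 ∧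
     ∑ i : Fin 10, (if i = 9 then (0 : ℤ) else 1) ^ 2 = 3 ^ 2) := by
  refine ⟨?_, by decide, by decide⟩
  intro c d hne h1 h2
  have hc : c ≠ 0 := by
    intro hc
    apply hne
    refine ⟨hc, ?_⟩
    rw [hc, zero_pow two_ne_zero, Finset.sum_eq_zero_iff_of_nonneg (fun i _ => sq_nonneg (d i))] at h2
    funext i
    exact pow_eq_zero_iff two_ne_zero |>.mp (h2 i (Finset.mem_univ i))
  have hle : |∑ i, d i| ≤ ∑ i, (d i) ^ 2 := by
    refine (Finset.abs_sum_le_sum_abs _ _).trans (Finset.sum_le_sum fun i _ => ?_)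
    rw [← sq_abs]
    exact Int.le_self_sq _
  rw [h1, h2, abs_mul, ← sq_abs c] at hle
  have hpos : 0 < |c| := abs_pos.mpr hc
  have h3 : |(3 : ℤ)| = 3 := rfl
  rw [h3] at hle
  nlinarith
end

section
/- Let a, b₁, …, b₁₀ be real numbers with b₁ ≥ b₂ ≥ ⋯ ≥ b₁₀, ∑_{i=1}^{10} bᵢ = 3a, b₁ + b₂ + b₃ ≤ a, and a² > ∑_{i=1}^{10} bᵢ². Then b₁₀ > 0 (and consequently a > 0). -/
/- Cauchy–Schwarz step: if b₁ ≥ ⋯ ≥ b₁₀, ∑bᵢ = 3a, b₁ + b₂ + b₃ ≤ a and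
   a² > ∑bᵢ², then b₁₀ > 0 (and consequently a > 0).
   (Indices shifted: bᵢ₊₁ is `b i` for i : Fin 10, so b₁₀ = b 9.) -/

theorem chamber_positive_square_forces_b10_pos (a : ℝ) (b : Fin 10 → ℝ)
    (hmono : ∀ i j : Fin 10, i ≤ j → b j ≤ b i)
    (hsum : ∑ i, b i = 3 * a)
    (h123 : b 0 + b 1 + b 2 ≤ a)
    (hsq : ∑ i, (b i) ^ 2 < a ^ 2) :
    0 < b 9 ∧ 0 < a := by
  simp only [Fin.sum_univ_succ, Fin.sum_univ_zero] at hsum hsq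
  simp [Fin.succ] at hsum hsq
  have m : ∀ j : Fin 10, 2 ≤ j → b j ≤ b 2 := fun j hj => hmono 2 j hj
  have h01 := hmono 0 2 (by decide)
  have h12 := hmono 1 2 (by decide)
  have h3 := m 3 (by decide)
  have h4 := m 4 (by decide)
  have h5 := m 5 (by decide)
  have h6 := m 6 (by decide)
  have h7 := m 7 (by decide)
  have h8 := m 8 (by decide)
  have h9 := m 9 (by decide)
  have ha0 : 0 ≤ a := by linarith
  have ha : 0 < a := by
    rcases ha0.lt_or_eq with h | h
    · exact h
    · exfalso
      rw [← h] at hsq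
      nlinarith [sq_nonneg (b 0), sq_nonneg (b 1), sq_nonneg (b 2), sq_nonneg (b 3),
        sq_nonneg (b 4), sq_nonneg (b 5), sq_nonneg (b 6), sq_nonneg (b 7),
        sq_nonneg (b 8), sq_nonneg (b 9)]
  refine ⟨?_, ha⟩
  by_contra hb
  have hp : 0 ≤ a * (-b 9) := mul_nonneg ha0 (by linarith)
  have hs : a * (3 * a) = a * (3 * a) := rfl
  nth_rewrite 1 [← hsum] at hs
  linarith [sq_nonneg (b 0 - a / 3), sq_nonneg (b 1 - a / 3), sq_nonneg (b 2 - a / 3),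
    sq_nonneg (b 3 - a / 3), sq_nonneg (b 4 - a / 3), sq_nonneg (b 5 - a / 3),
    sq_nonneg (b 6 - a / 3), sq_nonneg (b 7 - a / 3), sq_nonneg (b 8 - a / 3),
    sq_nonneg (b 9)]
end

section
/- (Reduction to the fundamental chamber.) Let G be the group of automorphisms of ℤ¹¹ generated by the reflections R_α(x) = x + ⟨α, x⟩α for α ∈ {lᵢ − l_j : 1 ≤ i < j ≤ 10} ∪ {l₀ − lᵢ − l_j − l_k : 1 ≤ i < j < k ≤ 10}. Then for every x = a·l₀ − ∑_{i=1}^{10} bᵢlᵢ ∈ ℤ¹¹ with a > 0, ∑_{i=1}^{10} bᵢ = 3a, and a² > ∑_{i=1}^{10} bᵢ², there exists g ∈ G such that g(x) = a'·l₀ − ∑_{i=1}^{10} b'ᵢlᵢ satisfies a' > 0, b'₁ ≥ b'₂ ≥ ⋯ ≥ b'₁₀, and b'₁ + b'₂ + b'₃ ≤ a'. -/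
/- Reduction to the fundamental chamber: every integral class
   x = a·l₀ − ∑bᵢlᵢ with a > 0, ∑bᵢ = 3a and a² > ∑bᵢ² can be moved, by a
   composition of the reflections R_α along α = lᵢ − l_j (1 ≤ i < j ≤ 10) and
   α = l₀ − lᵢ − l_j − l_k (1 ≤ i < j < k ≤ 10), into the chamber
   Δ̃ = {a' > 0, b'₁ ≥ ⋯ ≥ b'₁₀, b'₁ + b'₂ + b'₃ ≤ a'}.
   Since each generating reflection is an involution, the elements of the group G
   generated by them are exactly the finite compositions of the generators, which
   we encode by a list of roots. -/

namespace Stmt17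

def form (x y : Fin 11 → ℤ) : ℤ := x 0 * y 0 - ∑ i : Fin 10, x i.succ * y i.succ

/-- the basis vector l_i -/
def lv (i : Fin 11) : Fin 11 → ℤ := fun m => if m = i then 1 else 0

/-- the reflection R_α(x) = x + ⟨α,x⟩·α -/
def refl (α x : Fin 11 → ℤ) : Fin 11 → ℤ := fun m => x m + form α x * α m

/-- the roots lᵢ − l_j (1 ≤ i < j ≤ 10) and l₀ − lᵢ − l_j − l_k (1 ≤ i < j < k ≤ 10)
    generating the group G of reflections -/
def genRoots : Set (Fin 11 → ℤ) :=
  {α | ∃ i j : Fin 10, i < j ∧ α = lv i.succ - lv j.succ} ∪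
  {α | ∃ i j k : Fin 10, i < j ∧ j < k ∧ α = lv 0 - lv i.succ - lv j.succ - lv k.succ}

theorem form_swap (a : ℤ) (b : Fin 10 → ℤ) (i j : Fin 10) :
    form (lv i.succ - lv j.succ) (Fin.cons a fun i => -b i) = b i - b j := by
  simp [form, lv, sub_mul, Finset.sum_sub_distrib, Fin.succ_ne_zero, (Fin.succ_ne_zero _).symm]

theorem refl_swap (a : ℤ) (b : Fin 10 → ℤ) (i j : Fin 10) (hij : i ≠ j) :
    refl (lv i.succ - lv j.succ) (Fin.cons a fun i => -b i)
      = (Fin.cons a fun k => -b (Equiv.swap i j k)) := by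
  funext m
  unfold refl
  rw [form_swap]
  refine Fin.cases ?_ (fun k => ?_) m
  · simp [lv, (Fin.succ_ne_zero _).symm]
  · simp only [Fin.cons_succ, Pi.sub_apply, lv, Fin.succ_inj]
    by_cases h1 : k = i
    · subst h1
      simp [hij]
      ring
    · by_cases h2 : k = j
      · subst h2
        simp [h1]
        ring
      · simp [h1, h2, Equiv.swap_apply_of_ne_of_ne]

theorem perm_list (a : ℤ) (b : Fin 10 → ℤ) (σ : Equiv.Perm (Fin 10)) :
    ∃ L : List (Fin 11 → ℤ), (∀ α ∈ L, α ∈ genRoots) ∧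
      L.foldr refl (Fin.cons a fun i => -b i) = (Fin.cons a fun i => -b (σ i)) := by
  induction σ using Equiv.Perm.swap_induction_on' with
  | one => exact ⟨[], by simp, by simp⟩
  | mul_swap f x y hxy ih =>
    obtain ⟨L, hL, h⟩ := ih
    rcases lt_or_gt_of_ne hxy with hlt | hlt
    · refine ⟨(lv x.succ - lv y.succ) :: L, ?_, ?_⟩
      · intro α hα
        rcases List.mem_cons.1 hα with rfl | hα
        · exact Or.inl ⟨x, y, hlt, rfl⟩
        · exact hL α hα
      · rw [List.foldr_cons, h]
        exact refl_swap a (fun i => b (f i)) x y hxy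
    · refine ⟨(lv y.succ - lv x.succ) :: L, ?_, ?_⟩
      · intro α hα
        rcases List.mem_cons.1 hα with rfl | hα
        · exact Or.inl ⟨y, x, hlt, rfl⟩
        · exact hL α hα
      · rw [List.foldr_cons, h, Equiv.swap_comm]
        exact refl_swap a (fun i => b (f i)) y x hxy.symm

/-- the effect of the Cremona reflection on the coordinates `b` -/
def crem (a : ℤ) (b : Fin 10 → ℤ) : Fin 10 → ℤ :=
  fun i => if i = 0 ∨ i = 1 ∨ i = 2 then b i + (a - (b 0 + b 1 + b 2)) else b i

theorem refl_crem (a : ℤ) (b : Fin 10 → ℤ) :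
    refl (lv 0 - lv (0 : Fin 10).succ - lv (1 : Fin 10).succ - lv (2 : Fin 10).succ)
      (Fin.cons a fun i => -b i)
      = (Fin.cons (2 * a - (b 0 + b 1 + b 2)) fun k => -crem a b k) := by
  have hf : form (lv 0 - lv (0 : Fin 10).succ - lv (1 : Fin 10).succ - lv (2 : Fin 10).succ)
      (Fin.cons a fun i => -b i) = a - (b 0 + b 1 + b 2) := by
    simp only [form, lv, Pi.sub_apply, Fin.succ_inj, Fin.cons_succ, Fin.cons_zero, sub_mul,
      Finset.sum_sub_distrib, Fin.succ_ne_zero, (Fin.succ_ne_zero _).symm, if_false]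
    simp
  funext m
  unfold refl
  rw [hf]
  refine Fin.cases ?_ (fun k => ?_) m
  · simp only [Fin.cons_zero, Pi.sub_apply, lv, (Fin.succ_ne_zero _).symm, if_false, if_true]
    ring
  · simp only [Fin.cons_succ, Pi.sub_apply, lv, Fin.succ_inj, Fin.succ_ne_zero, if_false, crem]
    fin_cases k <;> simp <;> ring

theorem reduction_aux (n : ℕ) : ∀ (a : ℤ) (b : Fin 10 → ℤ), a.toNat = n →
    0 < a → ∑ i, (b i) ^ 2 < a ^ 2 →
    ∃ L : List (Fin 11 → ℤ), (∀ α ∈ L, α ∈ genRoots) ∧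
      ∃ (a' : ℤ) (b' : Fin 10 → ℤ),
        (L.foldr refl (Fin.cons a fun i => -b i)) = (Fin.cons a' fun i => -b' i) ∧
        0 < a' ∧ (∀ i j : Fin 10, i ≤ j → b' j ≤ b' i) ∧ b' 0 + b' 1 + b' 2 ≤ a' := by
  induction n using Nat.strong_induction_on with
  | _ n ih =>
    intro a b hn ha hsq
    obtain ⟨L, hL, h⟩ := perm_list a b (Tuple.sort fun i => -b i)
    have hmono : Monotone ((fun i => -b i) ∘ Tuple.sort fun i => -b i) := Tuple.monotone_sort _
    have hsq' : ∑ i, (b ((Tuple.sort fun i => -b i) i)) ^ 2 < a ^ 2 := by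
      rwa [Equiv.sum_comp (Tuple.sort fun i => -b i) (fun i => b i ^ 2)]
    generalize (Tuple.sort fun i => -b i) = σ at *
    obtain ⟨c, hc⟩ : ∃ c : Fin 10 → ℤ, c = fun i => b (σ i) := ⟨_, rfl⟩
    have hc' : ∀ i, b (σ i) = c i := fun i => by rw [hc]
    simp only [hc'] at h hsq'
    by_cases hs : c 0 + c 1 + c 2 ≤ a
    · refine ⟨L, hL, a, c, h, ha, ?_, hs⟩
      intro i j hij
      have := hmono hij
      simp only [Function.comp, hc'] at this
      linarith
    · push Not at hs
      have e : ∑ i, crem a c i ^ 2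
          = ∑ i, c i ^ 2 + (2 * a - (c 0 + c 1 + c 2)) ^ 2 - a ^ 2 := by
        simp [crem, Fin.sum_univ_succ]
        ring
      have h3 : c 0 ^ 2 + c 1 ^ 2 + c 2 ^ 2 ≤ ∑ i, c i ^ 2 := by
        have := Finset.sum_le_sum_of_subset_of_nonneg
          (Finset.subset_univ ({0, 1, 2} : Finset (Fin 10)))
          (f := fun i => c i ^ 2) (fun i _ _ => sq_nonneg _)
        simp at this
        linarith
      have hpos : 0 < 2 * a - (c 0 + c 1 + c 2) := by
        by_contra hneg
        nlinarith [sq_nonneg (c 0 - c 1), sq_nonneg (c 0 - c 2), sq_nonneg (c 1 - c 2)]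
      obtain ⟨L', hL', a', b', h1, h2⟩ := ih (2 * a - (c 0 + c 1 + c 2)).toNat (by omega)
        (2 * a - (c 0 + c 1 + c 2)) (crem a c) rfl hpos (by linarith)
      refine ⟨L' ++ ((lv 0 - lv (0 : Fin 10).succ - lv (1 : Fin 10).succ
        - lv (2 : Fin 10).succ) :: L), ?_, a', b', ?_, h2⟩
      · intro α hα
        rcases List.mem_append.1 hα with hα | hα
        · exact hL' α hα
        · rcases List.mem_cons.1 hα with rfl | hα
          · exact Or.inr ⟨0, 1, 2, by decide, by decide, rfl⟩
          · exact hL α hα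
      · rw [List.foldr_append, List.foldr_cons, h, refl_crem, h1]

theorem reduction_to_fundamental_chamber (a : ℤ) (b : Fin 10 → ℤ)
    (ha : 0 < a) (hsum : ∑ i, b i = 3 * a) (hsq : ∑ i, (b i) ^ 2 < a ^ 2) :
    ∃ L : List (Fin 11 → ℤ), (∀ α ∈ L, α ∈ genRoots) ∧
      ∃ (a' : ℤ) (b' : Fin 10 → ℤ),
        (L.foldr refl (Fin.cons a fun i => -b i)) = (Fin.cons a' fun i => -b' i) ∧
        0 < a' ∧ (∀ i j : Fin 10, i ≤ j → b' j ≤ b' i) ∧ b' 0 + b' 1 + b' 2 ≤ a' := by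
  exact reduction_aux _ a b rfl ha hsq

end Stmt17
end
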